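/- Let R₀ > 0, θ ∈ [0,1], δ₁ ∈ (0,1/2], and let g : ℝ → ℝ be a smooth function with 0 ≤ g ≤ 1, g(t) = 0 for t ≤ 0, and g(t) = 1 for t ≥ δ₁/2. For R > 0 define the cutoff φ^R : ℝ² → ℝ by φ^R(x) = g(R^{−θ}(R − |x|)). Let ω : ℝ² → ℝ be continuous with support contained in B(0,R₀), set m = ∫_{ℝ²} ω, let u(x) = (1/(2π)) ∫_{ℝ²} ((x−y)^⊥/|x−y|²) ω(y) dy, let ψ_R(x) = (1/(2π)) ∫_{ℝ²} log|x−y| ω(y) dy − (m/(2π)) log R, and let T_R u = ∇^⊥(φ^R ψ_R). Then there exists a constant C > 0, depending only on R₀, θ, δ₁ and g, such that for every R ≥ max(4R₀, 1): ‖u − T_R u‖_{L²(B(0,R))} ≤ C ( ‖ω‖_{L¹(ℝ²)} R^{−(1+θ)/2} + |m| R^{(θ−1)/2} ). -/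

import Mathlib

open MeasureTheory Real

/-- The perpendicular `z^⊥ = (-z₂, z₁)` of a vector in `ℝ²`. -/
noncomputable def perp (z : EuclideanSpace ℝ (Fin 2)) : EuclideanSpace ℝ (Fin 2) :=
  (EuclideanSpace.equiv (Fin 2) ℝ).symm ![-z 1, z 0]

/-- The perpendicular gradient `∇^⊥ f = (−∂₂f, ∂₁f)` of a scalar function on `ℝ²`. -/
noncomputable def perpGrad (f : EuclideanSpace ℝ (Fin 2) → ℝ)
    (x : EuclideanSpace ℝ (Fin 2)) : EuclideanSpace ℝ (Fin 2) :=
  (EuclideanSpace.equiv (Fin 2) ℝ).symm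
    ![-(fderiv ℝ f x (EuclideanSpace.single 1 1)),
      fderiv ℝ f x (EuclideanSpace.single 0 1)]

/-- The two-dimensional Biot–Savart law
`u(x) = (1/(2π)) ∫ ((x−y)^⊥/|x−y|²) ω(y) dy`. -/
noncomputable def biotSavart2D (ω : EuclideanSpace ℝ (Fin 2) → ℝ)
    (x : EuclideanSpace ℝ (Fin 2)) : EuclideanSpace ℝ (Fin 2) :=
  (1 / (2 * π)) • ∫ y, (ω y / ‖x - y‖ ^ 2) • perp (x - y)

/-- The stream function of `ω` normalized so that it vanishes at `|x| = R`
when `ω` is radial: `ψ_R(x) = (1/(2π)) ∫ log|x−y| ω(y) dy − (m/(2π)) log R`. -/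
noncomputable def streamR (ω : EuclideanSpace ℝ (Fin 2) → ℝ) (m R : ℝ)
    (x : EuclideanSpace ℝ (Fin 2)) : ℝ :=
  (1 / (2 * π)) * (∫ y, Real.log ‖x - y‖ * ω y) - (m / (2 * π)) * Real.log R

/-- The boundary-layer cutoff `φ^R(x) = g(R^{−θ}(R − |x|))`. -/
noncomputable def cutoff (g : ℝ → ℝ) (θ R : ℝ) (x : EuclideanSpace ℝ (Fin 2)) : ℝ :=
  g (R ^ (-θ) * (R - ‖x‖))

/-- The truncation operator `T_R u = ∇^⊥(φ^R ψ_R)`. -/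
noncomputable def truncate (g : ℝ → ℝ) (θ R : ℝ) (ω : EuclideanSpace ℝ (Fin 2) → ℝ)
    (m : ℝ) : EuclideanSpace ℝ (Fin 2) → EuclideanSpace ℝ (Fin 2) :=
  perpGrad (fun x => cutoff g θ R x * streamR ω m R x)

open MeasureTheory Real Filter Topology

abbrev E2 := EuclideanSpace ℝ (Fin 2)

noncomputable def Kt (t : ℝ) (z : E2) : E2 := (‖z‖ ^ 2 + t ^ 4)⁻¹ • z

lemma measurable_Kt (t : ℝ) : Measurable (Kt t) := by
  unfold Kt
  fun_prop

lemma Kt_norm (t : ℝ) (z : E2) : ‖Kt t z‖ = (‖z‖ ^ 2 + t ^ 4)⁻¹ * ‖z‖ := by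
  unfold Kt
  rw [norm_smul, Real.norm_of_nonneg (by positivity)]

lemma Kt_norm_le (t : ℝ) (z : E2) : ‖Kt t z‖ ≤ ‖z‖ ^ (-1 : ℝ) := by
  rw [Kt_norm, Real.rpow_neg_one]
  rcases eq_or_ne z 0 with rfl | hz
  · simp
  have h : 0 < ‖z‖ := norm_pos_iff.2 hz
  rw [inv_mul_le_iff₀ (by positivity), ← div_eq_mul_inv, le_div_iff₀ h]
  nlinarith [pow_nonneg (sq_nonneg t) 2]

lemma Kt_norm_le' {t : ℝ} (ht : 0 < t) (z : E2) : ‖Kt t z‖ ≤ 1 / t ^ 2 := by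
  rw [Kt_norm, inv_mul_le_iff₀ (by positivity), ← mul_div_assoc, le_div_iff₀ (by positivity)]
  nlinarith [sq_nonneg (‖z‖ - t ^ 2), sq_nonneg ‖z‖, sq_nonneg (t ^ 2)]

lemma Kt_sub_le {t : ℝ} (ht : 0 < t) (z : E2) :
    ‖Kt t z - Kt 0 z‖ ≤ t * ‖z‖ ^ (-(3 / 2) : ℝ) := by
  rcases eq_or_ne z 0 with rfl | hz
  · simp [Kt]
  have h : 0 < ‖z‖ := norm_pos_iff.2 hz
  have e : Kt t z - Kt 0 z = (-(t ^ 4 / (‖z‖ ^ 2 * (‖z‖ ^ 2 + t ^ 4)))) • z := by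
    unfold Kt
    rw [← sub_smul]
    congr 1
    field_simp
    ring
  rw [e, norm_smul, norm_neg, Real.norm_of_nonneg (by positivity)]
  obtain ⟨s, hs, hsz⟩ : ∃ s : ℝ, 0 < s ∧ ‖z‖ = s ^ 2 :=
    ⟨√‖z‖, by positivity, (Real.sq_sqrt h.le).symm⟩
  have : ‖z‖ ^ (-(3 / 2) : ℝ) = (s ^ 3)⁻¹ := by
    rw [hsz, ← Real.rpow_natCast, ← Real.rpow_mul hs.le, ← Real.rpow_natCast, ← Real.rpow_neg hs.le]
    norm_num
  rw [this, hsz, ← div_eq_mul_inv, div_mul_eq_mul_div, div_le_div_iff₀ (by positivity) (by positivity)]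
  have key : t ^ 3 * s ≤ s ^ 4 + t ^ 4 := by
    rcases le_total s t with h | h
    · have : t ^ 3 * s ≤ t ^ 3 * t := by gcongr
      nlinarith [pow_pos hs 4]
    · have : t ^ 3 * s ≤ s ^ 3 * s := by gcongr
      nlinarith [pow_pos ht 4]
  calc t ^ 4 * s ^ 2 * s ^ 3 = (t * s ^ 4) * (t ^ 3 * s) := by ring
    _ ≤ (t * s ^ 4) * (s ^ 4 + t ^ 4) := by gcongr
    _ = _ := by ring

lemma locInt {α : ℝ} (hα : α < 2) : LocallyIntegrable (fun z : E2 => ‖z‖ ^ (-α)) := by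
  refine locallyIntegrable_of_norm_le_rpow (C := 1) (α := α) (by simp) (by simpa using hα) ?_ ?_
  · refine ae_of_all _ fun x => ?_
    rw [Real.norm_of_nonneg (by positivity), one_mul]
  · exact (Measurable.pow_const measurable_norm _).aestronglyMeasurable

lemma int_pow {ω : E2 → ℝ} (hω : Continuous ω) (hc : HasCompactSupport ω) {α : ℝ} (hα : α < 2)
    (x : E2) : Integrable (fun y => ω y * ‖x - y‖ ^ (-α)) :=
  hc.convolutionExists_left (ContinuousLinearMap.mul ℝ ℝ) hω (locInt hα) x

lemma int_Kt {ω : E2 → ℝ} (hω : Continuous ω) (hc : HasCompactSupport ω) (t : ℝ)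
    (x : E2) : Integrable (fun y => ω y • Kt t (x - y)) := by
  refine (int_pow hω hc (α := 1) (by norm_num) x).mono ?_ (ae_of_all _ fun y => ?_)
  · exact (hω.measurable.smul ((measurable_Kt t).comp (by fun_prop))).aestronglyMeasurable
  · rw [norm_smul, norm_mul, Real.norm_of_nonneg (r := ‖x - y‖ ^ (-1 : ℝ)) (by positivity)]
    gcongr
    exact Kt_norm_le _ _

lemma abs_log_le {r : ℝ} (hr : 0 ≤ r) : |Real.log r| ≤ r ^ (-1 : ℝ) + r ^ (- -1 : ℝ) := by
  rcases hr.eq_or_lt with rfl | h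
  · simp
  rw [neg_neg, Real.rpow_one, Real.rpow_neg_one, abs_le]
  have h1 := Real.log_le_self hr
  have h2 := Real.log_le_self (inv_nonneg.2 hr)
  rw [Real.log_inv] at h2
  have : 0 < r⁻¹ := by positivity
  constructor <;> linarith

lemma int_log {ω : E2 → ℝ} (hω : Continuous ω) (hc : HasCompactSupport ω)
    (x : E2) : Integrable (fun y => Real.log ‖x - y‖ * ω y) := by
  refine ((int_pow hω hc (α := 1) (by norm_num) x).norm.add
    (int_pow hω hc (α := -1) (by norm_num) x).norm).mono' ?_ (ae_of_all _ fun y => ?_)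
  · exact ((Real.measurable_log.comp (by fun_prop)).mul hω.measurable).aestronglyMeasurable
  · simp only [Pi.add_apply]
    rw [norm_mul, norm_mul, norm_mul, Real.norm_of_nonneg (r := ‖x - y‖ ^ (-1 : ℝ)) (by positivity),
      Real.norm_of_nonneg (r := ‖x - y‖ ^ (- -1 : ℝ)) (by positivity), ← mul_add, mul_comm]
    gcongr
    exact abs_log_le (norm_nonneg _)

noncomputable def Lt (t : ℝ) (z : E2) : ℝ := 1 / 2 * Real.log (‖z‖ ^ 2 + t ^ 4)

lemma Lt_hasFDerivAt {t : ℝ} (ht : 0 < t) (z : E2) :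
    HasFDerivAt (Lt t) (innerSL ℝ (Kt t z)) z := by
  unfold Lt
  have h1 : HasFDerivAt (fun z : E2 => ‖z‖ ^ 2) (2 • innerSL ℝ z) z :=
    (hasStrictFDerivAt_norm_sq z).hasFDerivAt
  have h2 := ((h1.add_const (t ^ 4)).log (by positivity)).const_mul (1 / 2)
  refine h2.congr_fderiv ?_
  unfold Kt
  ext v
  simp
  ring

lemma Lt_cont {t : ℝ} (ht : 0 < t) : Continuous (Lt t) :=
  continuous_iff_continuousAt.2 fun z => (Lt_hasFDerivAt ht z).continuousAt

lemma Lt_sub_le {t : ℝ} (ht : 0 < t) {z : E2} (hz : z ≠ 0) :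
    |Lt t z - Real.log ‖z‖| ≤ t ^ 2 * ‖z‖ ^ (-1 : ℝ) := by
  have h : 0 < ‖z‖ := norm_pos_iff.2 hz
  have e : Real.log ‖z‖ = 1 / 2 * Real.log (‖z‖ ^ 2) := by rw [Real.log_pow]; push_cast; ring
  have h1 : Real.log (‖z‖ ^ 2) ≤ Real.log (‖z‖ ^ 2 + t ^ 4) :=
    Real.log_le_log (by positivity) (by linarith [pow_pos ht 4])
  have h2 : Real.log (‖z‖ ^ 2 + t ^ 4) ≤ Real.log ((‖z‖ * (1 + t ^ 2 * ‖z‖⁻¹)) ^ 2) := by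
    apply Real.log_le_log (by positivity)
    have : ‖z‖ * (1 + t ^ 2 * ‖z‖⁻¹) = ‖z‖ + t ^ 2 := by field_simp
    rw [this]
    nlinarith [mul_pos h (pow_pos ht 2)]
  rw [Real.log_pow, Real.log_mul h.ne' (by positivity)] at h2
  have h3 : Real.log (1 + t ^ 2 * ‖z‖⁻¹) ≤ t ^ 2 * ‖z‖⁻¹ := by
    have := Real.log_le_sub_one_of_pos (show 0 < 1 + t ^ 2 * ‖z‖⁻¹ by positivity)
    linarith
  rw [Real.rpow_neg_one, abs_le]
  unfold Lt
  push_cast at h2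
  have : 0 < t ^ 2 * ‖z‖⁻¹ := by positivity
  constructor <;> linarith

lemma int_Lt {ω : E2 → ℝ} (hω : Continuous ω) (hc : HasCompactSupport ω) {t : ℝ} (ht : 0 < t)
    (x : E2) : Integrable (fun y => Lt t (x - y) * ω y) :=
  (((Lt_cont ht).comp (by fun_prop : Continuous fun y => x - y)).mul hω).integrable_of_hasCompactSupport
    hc.mul_left

lemma pot_t_hasFDerivAt {ω : E2 → ℝ} (hω : Continuous ω) (hc : HasCompactSupport ω) {t : ℝ}
    (ht : 0 < t) (x : E2) :
    HasFDerivAt (fun x => ∫ y, Lt t (x - y) * ω y) (innerSL ℝ (∫ y, ω y • Kt t (x - y))) x := by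
  have e : innerSL ℝ (∫ y, ω y • Kt t (x - y)) = ∫ y, innerSL ℝ (ω y • Kt t (x - y)) :=
    ((innerSL ℝ : E2 →L[ℝ] E2 →L[ℝ] ℝ).integral_comp_comm (int_Kt hω hc t x)).symm
  rw [e]
  refine hasFDerivAt_integral_of_dominated_of_fderiv_le (s := Set.univ)
    (F' := fun x y => innerSL ℝ (ω y • Kt t (x - y))) (bound := fun y => ‖ω y‖ * (1 / t ^ 2))
    Filter.univ_mem ?_ (int_Lt hω hc ht x) ?_ ?_ ?_ ?_
  · exact Eventually.of_forall fun x => (int_Lt hω hc ht x).aestronglyMeasurable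
  · exact ((innerSL ℝ : E2 →L[ℝ] E2 →L[ℝ] ℝ).integrable_comp (int_Kt hω hc t x)).aestronglyMeasurable
  · refine ae_of_all _ fun y x _ => ?_
    rw [innerSL_apply_norm, norm_smul]
    gcongr
    exact Kt_norm_le' ht _
  · exact (hω.integrable_of_hasCompactSupport hc).norm.mul_const _
  · refine ae_of_all _ fun y x _ => ?_
    have h := ((Lt_hasFDerivAt ht (x - y)).comp x ((hasFDerivAt_id x).sub_const y)).mul_const (ω y)
    refine HasFDerivAt.congr_fderiv h ?_
    ext v
    simp

lemma pot_hasFDerivAt {ω : E2 → ℝ} (hω : Continuous ω) (hc : HasCompactSupport ω) (x₀ : E2) :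
    HasFDerivAt (fun x => ∫ y, Real.log ‖x - y‖ * ω y)
      (innerSL ℝ (∫ y, ω y • Kt 0 (x₀ - y))) x₀ := by
  have hca : HasCompactSupport (fun y => |ω y|) := hc.norm
  have hωa : Continuous (fun y => |ω y|) := hω.abs
  let H : E2 → ℝ := fun x => ∫ y, |ω y| * ‖x - y‖ ^ (-(3 / 2) : ℝ)
  have hH : Continuous H :=
    hca.continuous_convolution_left (ContinuousLinearMap.mul ℝ ℝ) hωa
      (locInt (α := 3 / 2) (by norm_num))
  obtain ⟨M, hM⟩ := (isCompact_closedBall x₀ 1).exists_bound_of_continuousOn hH.continuousOn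
  let τ : ℕ → ℝ := fun n => 1 / ((n : ℝ) + 1)
  have hτ : ∀ n, 0 < τ n := fun n => by positivity
  have hτ0 : Tendsto τ atTop (𝓝 0) := tendsto_one_div_add_atTop_nhds_zero_nat
  refine hasFDerivAt_of_tendstoUniformlyOn (l := atTop) (s := Metric.ball x₀ 1)
    (f := fun n x => ∫ y, Lt (τ n) (x - y) * ω y)
    (f' := fun n x => innerSL ℝ (∫ y, ω y • Kt (τ n) (x - y)))
    (g' := fun x => innerSL ℝ (∫ y, ω y • Kt 0 (x - y)))
    Metric.isOpen_ball ?_ (fun n x _ => pot_t_hasFDerivAt hω hc (hτ n) x) ?_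
    (Metric.mem_ball_self one_pos)
  · rw [Metric.tendstoUniformlyOn_iff]
    intro ε hε
    have h0 : Tendsto (fun n => τ n * M) atTop (𝓝 0) := by simpa using hτ0.mul_const M
    filter_upwards [h0.eventually_lt_const hε] with n hn x hx
    rw [dist_comm, dist_eq_norm, ← map_sub, innerSL_apply_norm,
      ← integral_sub (int_Kt hω hc _ x) (int_Kt hω hc _ x)]
    refine lt_of_le_of_lt ?_ hn
    calc _ ≤ ∫ y, τ n * (|ω y| * ‖x - y‖ ^ (-(3 / 2) : ℝ)) := by
          refine norm_integral_le_of_norm_le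
            ((int_pow hωa hca (α := 3 / 2) (by norm_num) x).const_mul _) (ae_of_all _ fun y => ?_)
          rw [← smul_sub, norm_smul, Real.norm_eq_abs]
          calc _ ≤ |ω y| * (τ n * ‖x - y‖ ^ (-(3 / 2) : ℝ)) := by
                gcongr
                exact Kt_sub_le (hτ n) _
            _ = _ := by ring
      _ = τ n * H x := integral_const_mul _ _
      _ ≤ τ n * M := by
          gcongr
          exact (le_abs_self _).trans (hM x (Metric.ball_subset_closedBall hx))
  · intro x _
    rw [tendsto_iff_norm_sub_tendsto_zero]
    have h0 : Tendsto (fun n => τ n ^ 2 * ∫ y, |ω y| * ‖x - y‖ ^ (-1 : ℝ)) atTop (𝓝 0) := by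
      simpa using (hτ0.pow 2).mul_const _
    refine squeeze_zero (fun _ => norm_nonneg _) (fun n => ?_) h0
    rw [← integral_sub (int_Lt hω hc (hτ n) x) (int_log hω hc x), ← integral_const_mul]
    refine norm_integral_le_of_norm_le
      ((int_pow hωa hca (α := 1) (by norm_num) x).const_mul _) ?_
    have : ∀ᵐ y : E2, y ≠ x := by simp [ae_iff]
    filter_upwards [this] with y hy
    rw [← sub_mul, norm_mul, Real.norm_eq_abs, Real.norm_eq_abs]
    calc _ ≤ (τ n ^ 2 * ‖x - y‖ ^ (-1 : ℝ)) * |ω y| := by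
          gcongr
          exact Lt_sub_le (hτ n) (sub_ne_zero.2 hy.symm)
      _ = _ := by ring

lemma perp_eq (z : E2) : perp z = !₂[-z 1, z 0] := rfl

lemma norm_perp (z : E2) : ‖perp z‖ = ‖z‖ := by
  rw [perp_eq, EuclideanSpace.norm_eq, EuclideanSpace.norm_eq]
  simp [Fin.sum_univ_two, add_comm]

noncomputable def perpL : E2 →ₗᵢ[ℝ] E2 where
  toFun := perp
  map_add' x y := by
    simp only [perp_eq]
    ext i
    fin_cases i <;> simp [add_comm]
  map_smul' c x := by
    simp only [perp_eq]
    ext i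
    fin_cases i <;> simp
  norm_map' := norm_perp

lemma perpL_apply (z : E2) : perpL z = perp z := rfl

lemma perpGrad_eq {f : E2 → ℝ} {v x : E2} (h : HasFDerivAt f (innerSL ℝ v) x) :
    perpGrad f x = perpL v := by
  rw [perpL_apply, perp_eq]
  unfold perpGrad
  rw [h.fderiv]
  ext i
  fin_cases i <;> simp [EuclideanSpace.inner_single_right]

noncomputable def V (ω : E2 → ℝ) (x : E2) : E2 := (1 / (2 * π)) • ∫ y, ω y • Kt 0 (x - y)

lemma biotSavart_eq {ω : E2 → ℝ} (hω : Continuous ω) (hc : HasCompactSupport ω) (x : E2) :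
    biotSavart2D ω x = perpL (V ω x) := by
  unfold biotSavart2D V
  rw [map_smul]
  congr 1
  have h := perpL.toContinuousLinearMap.integral_comp_comm (int_Kt hω hc 0 x)
  refine Eq.trans ?_ h
  congr 1
  ext1 y
  change _ = perpL _
  rw [map_smul, Kt, map_smul, perpL_apply, smul_smul]
  congr 1
  simp [div_eq_mul_inv]

lemma stream_hasFDerivAt {ω : E2 → ℝ} (hω : Continuous ω) (hc : HasCompactSupport ω) (m R : ℝ)
    (x : E2) : HasFDerivAt (streamR ω m R) (innerSL ℝ (V ω x)) x := by
  unfold streamR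
  have h := ((pot_hasFDerivAt hω hc x).const_mul (1 / (2 * π))).sub_const
    ((m / (2 * π)) * Real.log R)
  refine h.congr_fderiv ?_
  unfold V
  rw [map_smul]

lemma Kt0_sub {a b : E2} (ha : a ≠ 0) (hb : b ≠ 0) :
    ‖Kt 0 a - Kt 0 b‖ = ‖a - b‖ / (‖a‖ * ‖b‖) := by
  have := dist_div_norm_sq_smul ha hb 1
  rw [dist_eq_norm, dist_eq_norm] at this
  unfold Kt
  simp only [one_div, inv_pow, one_pow] at this
  simp only [ne_eq, OfNat.ofNat_ne_zero, not_false_eq_true, zero_pow, add_zero]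
  rw [this]
  ring

lemma abs_log_sub {a b c : ℝ} (hc : 0 < c) (ha : c ≤ a) (hb : c ≤ b) :
    |Real.log a - Real.log b| ≤ |a - b| / c := by
  have key : ∀ a b : ℝ, c ≤ a → c ≤ b → Real.log a - Real.log b ≤ |a - b| / c := by
    intro a b ha hb
    have ha' := hc.trans_le ha
    have hb' := hc.trans_le hb
    rw [← Real.log_div ha'.ne' hb'.ne']
    have h1 := Real.log_le_sub_one_of_pos (div_pos ha' hb')
    have h2 : a / b - 1 = (a - b) / b := by field_simp
    rw [h2] at h1
    refine h1.trans ?_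
    calc (a - b) / b ≤ |a - b| / b := by gcongr; exact le_abs_self _
      _ ≤ |a - b| / c := by gcongr
  rw [abs_le]
  have h1 := key a b ha hb
  have h2 := key b a hb ha
  rw [abs_sub_comm] at h2
  constructor <;> linarith

lemma two_pi_inv_le : 1 / (2 * π) ≤ 1 := by
  rw [div_le_one (by positivity)]
  linarith [Real.pi_gt_three]

lemma V_bound {ω : E2 → ℝ} (hω : Continuous ω) (hc : HasCompactSupport ω) {R₀ R : ℝ}
    (hs : ∀ y, ω y ≠ 0 → ‖y‖ ≤ R₀) (hR₀ : 0 < R₀) (hR : 4 * R₀ ≤ R) {x : E2}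
    (hx : 3 / 4 * R ≤ ‖x‖) :
    ‖V ω x‖ ≤ |∫ y, ω y| * (2 / R) + R₀ * (∫ y, |ω y|) * (3 / R ^ 2) := by
  have hRp : 0 < R := by linarith
  have hxp : 0 < ‖x‖ := by linarith
  have hx0 : x ≠ 0 := norm_pos_iff.1 hxp
  have hi := hω.integrable_of_hasCompactSupport hc (μ := volume)
  have e : ∫ y, ω y • Kt 0 (x - y) = (∫ y, ω y) • Kt 0 x + ∫ y, ω y • (Kt 0 (x - y) - Kt 0 x) := by
    simp_rw [smul_sub]
    rw [integral_sub (int_Kt hω hc 0 x) (hi.smul_const _), integral_smul_const]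
    abel
  have h1 : ‖Kt 0 x‖ ≤ 2 / R := by
    refine (Kt_norm_le 0 x).trans ?_
    rw [Real.rpow_neg_one, inv_le_comm₀ hxp (by positivity), inv_div]
    linarith
  have h2 : ‖∫ y, ω y • (Kt 0 (x - y) - Kt 0 x)‖ ≤ ∫ y, |ω y| * (R₀ * (3 / R ^ 2)) := by
    refine norm_integral_le_of_norm_le (hi.abs.mul_const _) (ae_of_all _ fun y => ?_)
    rw [norm_smul, Real.norm_eq_abs]
    by_cases hy : ω y = 0
    · simp [hy]
    have hy' := hs y hy
    have h3 : R / 2 ≤ ‖x - y‖ := by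
      have := norm_sub_norm_le x y
      linarith
    have h4 : x - y ≠ 0 := norm_pos_iff.1 (by linarith)
    gcongr
    rw [Kt0_sub h4 hx0, sub_sub_cancel_left, norm_neg, div_le_iff₀ (by positivity)]
    have h5 : R / 2 * (3 / 4 * R) ≤ ‖x - y‖ * ‖x‖ := by gcongr
    calc ‖y‖ ≤ R₀ * 1 := by linarith
      _ ≤ R₀ * ((3 / R ^ 2) * (R / 2 * (3 / 4 * R))) := by
          gcongr
          field_simp
          norm_num
      _ ≤ R₀ * ((3 / R ^ 2) * (‖x - y‖ * ‖x‖)) := by gcongr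
      _ = _ := by ring
  rw [integral_mul_const] at h2
  unfold V
  rw [norm_smul, Real.norm_of_nonneg (by positivity), e]
  calc _ ≤ 1 * ‖(∫ y, ω y) • Kt 0 x + ∫ y, ω y • (Kt 0 (x - y) - Kt 0 x)‖ := by
        gcongr
        exact two_pi_inv_le
    _ ≤ ‖(∫ y, ω y) • Kt 0 x‖ + ‖∫ y, ω y • (Kt 0 (x - y) - Kt 0 x)‖ := by
        rw [one_mul]; exact norm_add_le _ _
    _ ≤ |∫ y, ω y| * (2 / R) + (∫ y, |ω y|) * (R₀ * (3 / R ^ 2)) := by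
        rw [norm_smul, Real.norm_eq_abs]
        gcongr
    _ = _ := by ring

lemma stream_bound {ω : E2 → ℝ} (hω : Continuous ω) (hc : HasCompactSupport ω) {R₀ R : ℝ}
    (hs : ∀ y, ω y ≠ 0 → ‖y‖ ≤ R₀) (hR₀ : 0 < R₀) (hR : 4 * R₀ ≤ R) {x : E2}
    (hx : 3 / 4 * R ≤ ‖x‖) :
    |streamR ω (∫ y, ω y) R x| ≤ |∫ y, ω y| * (|‖x‖ - R| / (R / 2)) +
      R₀ * (∫ y, |ω y|) * (2 / R) := by
  have hRp : 0 < R := by linarith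
  have hxp : 0 < ‖x‖ := by linarith
  have hi := hω.integrable_of_hasCompactSupport hc (μ := volume)
  have e : streamR ω (∫ y, ω y) R x = (1 / (2 * π)) * ((∫ y, ω y) * (Real.log ‖x‖ - Real.log R) +
      ∫ y, (Real.log ‖x - y‖ - Real.log ‖x‖) * ω y) := by
    simp_rw [sub_mul]
    rw [integral_sub (int_log hω hc x) (hi.const_mul _), integral_const_mul]
    unfold streamR
    ring
  have h2 : ‖∫ y, (Real.log ‖x - y‖ - Real.log ‖x‖) * ω y‖ ≤ ∫ y, |ω y| * (R₀ * (2 / R)) := by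
    refine norm_integral_le_of_norm_le (hi.abs.mul_const _) (ae_of_all _ fun y => ?_)
    rw [norm_mul, Real.norm_eq_abs, Real.norm_eq_abs, mul_comm]
    by_cases hy : ω y = 0
    · simp [hy]
    have hy' := hs y hy
    have h3 : R / 2 ≤ ‖x - y‖ := by
      have := norm_sub_norm_le x y
      linarith
    gcongr
    refine (abs_log_sub (c := R / 2) (by linarith) h3 (by linarith)).trans ?_
    have h6 : |‖x - y‖ - ‖x‖| ≤ R₀ := by
      refine (abs_norm_sub_norm_le _ _).trans ?_
      simpa using hy'
    calc _ ≤ R₀ / (R / 2) := by gcongr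
      _ = _ := by field_simp
  rw [integral_mul_const, Real.norm_eq_abs] at h2
  rw [e, abs_mul, abs_of_nonneg (a := 1 / (2 * π)) (by positivity)]
  calc _ ≤ 1 * |(∫ y, ω y) * (Real.log ‖x‖ - Real.log R) +
      ∫ y, (Real.log ‖x - y‖ - Real.log ‖x‖) * ω y| := by
        gcongr
        exact two_pi_inv_le
    _ ≤ |(∫ y, ω y) * (Real.log ‖x‖ - Real.log R)| +
      |∫ y, (Real.log ‖x - y‖ - Real.log ‖x‖) * ω y| := by
        rw [one_mul]; exact abs_add_le _ _
    _ ≤ |∫ y, ω y| * (|‖x‖ - R| / (R / 2)) + (∫ y, |ω y|) * (R₀ * (2 / R)) := by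
        rw [abs_mul]
        gcongr
        exact abs_log_sub (by linarith) (by linarith) (by linarith)
    _ = _ := by ring

lemma cutoff_hasFDerivAt {g : ℝ → ℝ} (hg : Differentiable ℝ g) (θ R : ℝ) {x : E2} (hx : x ≠ 0) :
    HasFDerivAt (cutoff g θ R)
      (innerSL ℝ ((deriv g (R ^ (-θ) * (R - ‖x‖)) * (R ^ (-θ) * (-‖x‖⁻¹))) • x)) x := by
  unfold cutoff
  have h1 : HasFDerivAt (fun z : E2 => ‖z‖ ^ 2) (2 • innerSL ℝ x) x :=
    (hasStrictFDerivAt_norm_sq x).hasFDerivAt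
  have hxp : 0 < ‖x‖ := norm_pos_iff.2 hx
  have h2 := h1.sqrt (by positivity)
  simp only [Real.sqrt_sq (norm_nonneg _)] at h2
  have h3 := (h2.const_sub R).const_mul (R ^ (-θ))
  have h4 := ((hg (R ^ (-θ) * (R - ‖x‖))).hasDerivAt).comp_hasFDerivAt x h3
  refine HasFDerivAt.congr_fderiv h4 ?_
  ext v
  simp
  field_simp
  try ring

lemma trunc_inner {g : ℝ → ℝ} {θ δ R : ℝ} (hR : 0 < R) (hg1 : ∀ t, δ / 2 ≤ t → g t = 1)
    {ω : E2 → ℝ} (hω : Continuous ω) (hc : HasCompactSupport ω) (m : ℝ) {x : E2}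
    (hx : ‖x‖ < R - δ / 2 * R ^ θ) :
    biotSavart2D ω x - truncate g θ R ω m x = 0 := by
  have hev : (fun x => cutoff g θ R x * streamR ω m R x) =ᶠ[𝓝 x] streamR ω m R := by
    have ho : IsOpen {z : E2 | ‖z‖ < R - δ / 2 * R ^ θ} :=
      isOpen_lt continuous_norm continuous_const
    filter_upwards [ho.mem_nhds hx] with z hz
    have hz' : ‖z‖ < R - δ / 2 * R ^ θ := hz
    have : cutoff g θ R z = 1 := by
      apply hg1
      have hp : 0 < R ^ θ := by positivity
      rw [Real.rpow_neg hR.le, ← div_eq_inv_mul, le_div_iff₀ hp]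
      linarith
    rw [this, one_mul]
  have h := (stream_hasFDerivAt hω hc m R x).congr_of_eventuallyEq hev
  unfold truncate
  rw [perpGrad_eq h, biotSavart_eq hω hc, sub_self]

lemma trunc_outer {g : ℝ → ℝ} {θ δ R R₀ G : ℝ} (hR1 : 1 ≤ R) (hθ : θ ∈ Set.Icc (0:ℝ) 1)
    (hδ : δ ∈ Set.Ioc (0:ℝ) (1/2)) (hg : Differentiable ℝ g)
    (hg01 : ∀ t, g t ∈ Set.Icc (0:ℝ) 1) (hG0 : 0 ≤ G)
    (hG : ∀ t ∈ Set.Icc 0 (δ / 2), |deriv g t| ≤ G)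
    {ω : E2 → ℝ} (hω : Continuous ω) (hc : HasCompactSupport ω)
    (hs : ∀ y, ω y ≠ 0 → ‖y‖ ≤ R₀) (hR₀ : 0 < R₀) (hR : 4 * R₀ ≤ R) {x : E2}
    (hx : R - δ / 2 * R ^ θ ≤ ‖x‖) (hxR : ‖x‖ < R) :
    ‖biotSavart2D ω x - truncate g θ R ω (∫ y, ω y) x‖ ≤
      (2 + G) * |∫ y, ω y| * R ^ (-1 : ℝ) + R₀ * (3 + 2 * G) * (∫ y, |ω y|) * R ^ (-1 - θ) := by
  have hRp : 0 < R := by linarith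
  have hp : 0 < R ^ θ := by positivity
  have hRθ : R ^ θ ≤ R := by
    calc R ^ θ ≤ R ^ (1 : ℝ) := Real.rpow_le_rpow_of_exponent_le hR1 hθ.2
      _ = R := Real.rpow_one R
  have hx34 : 3 / 4 * R ≤ ‖x‖ := by nlinarith [hδ.1, hδ.2]
  have hxp : 0 < ‖x‖ := by linarith
  have hx0 : x ≠ 0 := norm_pos_iff.1 hxp
  set m := ∫ y, ω y with hm
  set I := ∫ y, |ω y| with hI
  have hI0 : 0 ≤ I := integral_nonneg fun _ => abs_nonneg _
  set s := R ^ (-θ) * (R - ‖x‖) with hsdef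
  have hsI : s ∈ Set.Icc 0 (δ / 2) := by
    rw [hsdef, Real.rpow_neg hRp.le, ← div_eq_inv_mul]
    constructor
    · exact div_nonneg (by linarith) hp.le
    · rw [div_le_iff₀ hp]; linarith
  set W := (deriv g s * (R ^ (-θ) * (-‖x‖⁻¹))) • x with hW
  have hWn : ‖W‖ ≤ G * R ^ (-θ) := by
    rw [hW, norm_smul, norm_mul, norm_mul, norm_neg, norm_inv, norm_norm, Real.norm_eq_abs,
      Real.norm_of_nonneg (r := R ^ (-θ)) (by positivity), mul_assoc, mul_assoc,
      inv_mul_cancel₀ hxp.ne', mul_one]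
    gcongr
    exact hG s hsI
  have hprod := (cutoff_hasFDerivAt hg θ R hx0).mul (stream_hasFDerivAt hω hc m R x)
  have hprod' : HasFDerivAt (fun x => cutoff g θ R x * streamR ω m R x)
      (innerSL ℝ (g s • V ω x + streamR ω m R x • W)) x := by
    refine HasFDerivAt.congr_fderiv hprod ?_
    rw [map_add, (innerSL ℝ).map_smul (g s), (innerSL ℝ).map_smul (streamR ω m R x)]
    rfl
  have e : biotSavart2D ω x - truncate g θ R ω m x =
      perpL ((1 - g s) • V ω x - streamR ω m R x • W) := by
    unfold truncate
    rw [perpGrad_eq hprod', biotSavart_eq hω hc, ← map_sub]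
    congr 1
    rw [sub_smul, one_smul]
    abel
  rw [e, perpL.norm_map]
  have hV := V_bound hω hc hs hR₀ hR hx34
  have hS := stream_bound hω hc hs hR₀ hR hx34
  rw [← hm, ← hI] at hV hS
  have hS1 : |‖x‖ - R| / (R / 2) ≤ R ^ θ * R⁻¹ := by
    rw [abs_sub_comm, abs_of_nonneg (by linarith), div_le_iff₀ (by linarith)]
    have : R ^ θ * R⁻¹ * (R / 2) = R ^ θ / 2 := by field_simp
    rw [this]
    nlinarith [hδ.2]
  have r1 : R ^ (-1 : ℝ) = R⁻¹ := Real.rpow_neg_one R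
  have r2 : R ^ (-1 - θ) = R⁻¹ * R ^ (-θ) := by
    rw [sub_eq_add_neg, Real.rpow_add hRp, r1]
  have r3 : R ^ (-θ) * R ^ θ = 1 := by rw [← Real.rpow_add hRp]; simp
  have r4 : R⁻¹ ≤ R ^ (-θ) := by
    rw [← r1]; exact Real.rpow_le_rpow_of_exponent_le hR1 (by linarith [hθ.2])
  have hg' : |1 - g s| ≤ 1 := by
    have := hg01 s
    rw [abs_le]; constructor <;> linarith [this.1, this.2]
  have hRi : 0 < R⁻¹ := by positivity
  have hq : 0 < R ^ (-θ) := by positivity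
  calc _ ≤ ‖(1 - g s) • V ω x‖ + ‖streamR ω m R x • W‖ := norm_sub_le _ _
    _ ≤ 1 * (|m| * (2 / R) + R₀ * I * (3 / R ^ 2)) +
        (|m| * (R ^ θ * R⁻¹) + R₀ * I * (2 / R)) * (G * R ^ (-θ)) := by
        rw [norm_smul, norm_smul, Real.norm_eq_abs, Real.norm_eq_abs]
        gcongr
        exact hS.trans (by gcongr)
    _ = |m| * R⁻¹ * (2 + G * (R ^ (-θ) * R ^ θ)) + R₀ * I * R⁻¹ * (3 * R⁻¹ + 2 * G * R ^ (-θ)) := by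
        field_simp
        ring
    _ ≤ |m| * R⁻¹ * (2 + G * (R ^ (-θ) * R ^ θ)) +
        R₀ * I * R⁻¹ * (3 * R ^ (-θ) + 2 * G * R ^ (-θ)) := by
        gcongr
    _ = _ := by rw [r3, r1, r2]; ring

lemma annulus_vol {θ δ R : ℝ} (hR1 : 1 ≤ R) (hθ : θ ∈ Set.Icc (0:ℝ) 1)
    (hδ : δ ∈ Set.Ioc (0:ℝ) (1/2)) :
    volume (Metric.ball (0 : E2) R \ Metric.ball (0 : E2) (R - δ / 2 * R ^ θ)) ≤
      ENNReal.ofReal ((2 * R ^ ((1 + θ) / 2)) ^ 2) := by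
  have hRp : 0 < R := by linarith
  have hp : 0 < R ^ θ := by positivity
  have hRθ : R ^ θ ≤ R := by
    calc R ^ θ ≤ R ^ (1 : ℝ) := Real.rpow_le_rpow_of_exponent_le hR1 hθ.2
      _ = R := Real.rpow_one R
  have h0 : 0 ≤ R - δ / 2 * R ^ θ := by nlinarith [hδ.1, hδ.2]
  have e1 : (2 * R ^ ((1 + θ) / 2)) ^ 2 = 4 * (R * R ^ θ) := by
    rw [mul_pow, ← Real.rpow_natCast (R ^ ((1 + θ) / 2)), ← Real.rpow_mul hRp.le,
      show (1 + θ) / 2 * ((2 : ℕ) : ℝ) = 1 + θ by push_cast; ring, Real.rpow_add hRp, Real.rpow_one]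
    norm_num
  rw [measure_sdiff (Metric.ball_subset_ball (by nlinarith [hδ.1]))
    measurableSet_ball.nullMeasurableSet measure_ball_lt_top.ne,
    EuclideanSpace.volume_ball_fin_two, EuclideanSpace.volume_ball_fin_two,
    ← ENNReal.ofReal_pow hRp.le, ← ENNReal.ofReal_pow h0, ← ENNReal.ofReal_mul (by positivity),
    ← ENNReal.ofReal_mul (by positivity), ← ENNReal.ofReal_sub _ (by positivity)]
  apply ENNReal.ofReal_le_ofReal
  rw [e1, ← sub_mul]
  have h1 : R ^ 2 - (R - δ / 2 * R ^ θ) ^ 2 ≤ R * R ^ θ := by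
    nlinarith [mul_pos hRp hp, hδ.1, hδ.2, sq_nonneg (δ / 2 * R ^ θ)]
  have h2 : 0 ≤ R * R ^ θ := by positivity
  nlinarith [Real.pi_lt_four, Real.pi_pos]

theorem truncation_L2_velocity (R₀ θ δ₁ : ℝ) (hR₀ : 0 < R₀)
    (hθ : θ ∈ Set.Icc (0:ℝ) 1) (hδ₁ : δ₁ ∈ Set.Ioc (0:ℝ) (1/2))
    (g : ℝ → ℝ) (hg : ContDiff ℝ (⊤ : ℕ∞) g)
    (hg01 : ∀ t, g t ∈ Set.Icc (0:ℝ) 1)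
    (hg0 : ∀ t ≤ (0:ℝ), g t = 0)
    (hg1 : ∀ t, δ₁ / 2 ≤ t → g t = 1) :
    ∃ C > 0, ∀ ω : EuclideanSpace ℝ (Fin 2) → ℝ,
      Continuous ω →
      Function.support ω ⊆ Metric.closedBall 0 R₀ →
      ∀ R : ℝ, max (4 * R₀) 1 ≤ R →
        eLpNorm
            (fun x => biotSavart2D ω x - truncate g θ R ω (∫ y, ω y) x) 2
            (volume.restrict (Metric.ball 0 R)) ≤
          ENNReal.ofReal (C * ((∫ y, |ω y|) * R ^ (-((1 + θ) / 2)) +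
            |∫ y, ω y| * R ^ ((θ - 1) / 2))) := by
  have hgd : Differentiable ℝ g := hg.differentiable (by simp)
  have hgc : Continuous (deriv g) := hg.continuous_deriv (by simp)
  obtain ⟨G, hG⟩ := (isCompact_Icc (a := (0:ℝ)) (b := δ₁ / 2)).exists_bound_of_continuousOn
    hgc.continuousOn
  have hG0 : 0 ≤ G := (norm_nonneg _).trans (hG 0 ⟨le_rfl, by linarith [hδ₁.1]⟩)
  refine ⟨2 * ((2 + G) + R₀ * (3 + 2 * G)), by positivity, ?_⟩
  intro ω hω hsupp R hR
  have hR1 : 1 ≤ R := (le_max_right _ _).trans hR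
  have hR4 : 4 * R₀ ≤ R := (le_max_left _ _).trans hR
  have hRp : 0 < R := by linarith
  have hc : HasCompactSupport ω :=
    HasCompactSupport.of_support_subset_isCompact (isCompact_closedBall 0 R₀) hsupp
  have hs : ∀ y, ω y ≠ 0 → ‖y‖ ≤ R₀ := fun y hy => by
    simpa using hsupp (Function.mem_support.2 hy)
  set m := ∫ y, ω y with hm
  set I := ∫ y, |ω y| with hI
  have hI0 : 0 ≤ I := integral_nonneg fun _ => abs_nonneg _
  set B := (2 + G) * |m| * R ^ (-1 : ℝ) + R₀ * (3 + 2 * G) * I * R ^ (-1 - θ) with hB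
  have hB0 : 0 ≤ B := by positivity
  set A := (Metric.ball (0 : E2) R \ Metric.ball (0 : E2) (R - δ₁ / 2 * R ^ θ)) with hA
  have hAm : MeasurableSet A := measurableSet_ball.diff measurableSet_ball
  calc _ ≤ eLpNorm (A.indicator fun _ => B) 2 (volume.restrict (Metric.ball (0 : E2) R)) := by
        refine eLpNorm_mono_ae ?_
        filter_upwards [ae_restrict_mem measurableSet_ball] with x hx
        by_cases h : ‖x‖ < R - δ₁ / 2 * R ^ θ
        · rw [trunc_inner hRp hg1 hω hc m h, norm_zero]
          exact norm_nonneg _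
        · have hxA : x ∈ A := ⟨hx, by simpa using h⟩
          rw [Set.indicator_of_mem hxA, Real.norm_of_nonneg hB0]
          exact trunc_outer hR1 hθ hδ₁ hgd hg01 hG0 hG hω hc hs hR₀ hR4 (not_lt.1 h)
            (by simpa using hx)
    _ ≤ ENNReal.ofReal B * (ENNReal.ofReal ((2 * R ^ ((1 + θ) / 2)) ^ 2)) ^ (1 / 2 : ℝ) := by
        rw [eLpNorm_indicator_const hAm (by simp) (by simp), Real.enorm_of_nonneg hB0]
        simp only [ENNReal.toReal_ofNat]
        gcongr
        exact (Measure.restrict_apply_le _ _).trans (annulus_vol hR1 hθ hδ₁)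
    _ = ENNReal.ofReal (B * (2 * R ^ ((1 + θ) / 2))) := by
        rw [ENNReal.ofReal_rpow_of_nonneg (by positivity) (by norm_num), ← Real.sqrt_eq_rpow,
          Real.sqrt_sq (by positivity), ← ENNReal.ofReal_mul hB0]
    _ ≤ _ := by
        apply ENNReal.ofReal_le_ofReal
        have q1 : R ^ (-1 : ℝ) * R ^ ((1 + θ) / 2) = R ^ ((θ - 1) / 2) := by
          rw [← Real.rpow_add hRp]; congr 1; ring
        have q2 : R ^ (-1 - θ) * R ^ ((1 + θ) / 2) = R ^ (-((1 + θ) / 2)) := by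
          rw [← Real.rpow_add hRp]; congr 1; ring
        have e : B * (2 * R ^ ((1 + θ) / 2)) = 2 * ((2 + G) * (|m| * R ^ ((θ - 1) / 2)) +
            R₀ * (3 + 2 * G) * (I * R ^ (-((1 + θ) / 2)))) := by
          rw [hB, ← q1, ← q2]; ring
        rw [e]
        have p1 : 0 ≤ |m| * R ^ ((θ - 1) / 2) := by positivity
        have p2 : 0 ≤ I * R ^ (-((1 + θ) / 2)) := by positivity
        have p3 : 0 ≤ R₀ * (3 + 2 * G) := by positivity
        nlinarith [mul_nonneg p3 p1, mul_nonneg (show 0 ≤ 2 + G by positivity) p2]
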